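/- arXiv:math/0605284 — 7 statements merged into one kernel-verified Lean document; each statement's English description precedes it below -/
import Mathlib

section
/- Let N ≥ 2 be an integer, δ, μ > 0, R > 0, and suppose either N/(N−1) < p ≤ q ≤ 2 or 2 ≤ p ≤ q < N; set k₂ = p/(p−1) in the first case and k₂ = q + (N−q)(q−2)/(q−1) in the second case. Let (u,v) be a regular radial solution of system (S_R). Define for r ∈ (0,R]: E₂(r) = r^{N+k₂−2}|u'(r)|^{p−1}|v'(r)|^{q−1} − (N/(δ+1)) r^{N−1}|u'(r)|^{p−1} ∫_r^R s^{k₂−2}|v'(s)|^{q−1} ds − (N/(μ+1)) r^{N−1}|v'(r)|^{q−1} ∫_r^R s^{k₂−2}|u'(s)|^{p−1} ds + r^N ∫_r^R s^{k₂−2}|v'(s)|^{q−1} v(s)^δ ds + r^N ∫_r^R s^{k₂−2}|u'(s)|^{p−1} u(s)^μ ds. Then E₂ is differentiable on (0,R) and for every r ∈ (0,R): E₂'(r) = (k₂ − N + N/(δ+1) + N/(μ+1)) r^{N+k₂−3}|u'(r)|^{p−1}|v'(r)|^{q−1} − (N/(δ+1)) r^{N−1} v(r)^δ ∫_r^R s^{k₂−2}|v'(s)|^{q−1}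 ds + N r^{N−1} ∫_r^R s^{k₂−2}|v'(s)|^{q−1} v(s)^δ ds − (N/(μ+1)) r^{N−1} u(r)^μ ∫_r^R s^{k₂−2}|u'(s)|^{p−1} ds + N r^{N−1} ∫_r^R s^{k₂−2}|u'(s)|^{p−1} u(s)^μ ds. -/
open MeasureTheory

/-- A regular radial solution of system (S_R) on the ball of radius `R`. -/
def IsRadialSolution (N : ℕ) (p q δ μ R : ℝ) (u v : ℝ → ℝ) : Prop :=
  ContDiffOn ℝ 1 u (Set.Icc 0 R) ∧ ContDiffOn ℝ 1 v (Set.Icc 0 R) ∧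
  ContDiffOn ℝ 2 u (Set.Ioc 0 R) ∧ ContDiffOn ℝ 2 v (Set.Ioc 0 R) ∧
  (∀ r ∈ Set.Ico (0:ℝ) R, 0 < u r) ∧ (∀ r ∈ Set.Ico (0:ℝ) R, 0 < v r) ∧
  deriv u 0 = 0 ∧ deriv v 0 = 0 ∧ u R = 0 ∧ v R = 0 ∧
  (∀ r ∈ Set.Ioc (0:ℝ) R,
    deriv (fun s => s ^ ((N:ℝ) - 1) * |deriv u s| ^ (p - 2) * deriv u s) r
      = -(r ^ ((N:ℝ) - 1) * v r ^ δ)) ∧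
  (∀ r ∈ Set.Ioc (0:ℝ) R,
    deriv (fun s => s ^ ((N:ℝ) - 1) * |deriv v s| ^ (q - 2) * deriv v s) r
      = -(r ^ ((N:ℝ) - 1) * u r ^ μ))

open Set Filter Topology in
/-- Differentiation in the lower endpoint of an integral whose integrand agrees on `(0, R)` with a
function continuous on `(0, R]`. -/
theorem hasDerivAt_setIntegral_Ioc_left {R : ℝ} {g G : ℝ → ℝ} (hgG : EqOn g G (Ioo 0 R))
    (hG : ContinuousOn G (Ioc 0 R)) {r : ℝ} (hr : r ∈ Ioo 0 R) :
    HasDerivAt (fun t => ∫ s in Ioc t R, g s) (-g r) r := by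
  have hnhds : Ioo 0 R ∈ 𝓝 r := isOpen_Ioo.mem_nhds hr
  have hgc : ContinuousOn g (Ioo 0 R) :=
    (hG.mono Ioo_subset_Ioc_self).congr hgG
  have hint : IntervalIntegrable g volume r R := by
    have hGi : IntervalIntegrable G volume r R := by
      apply ContinuousOn.intervalIntegrable
      rw [uIcc_of_le hr.2.le]
      exact hG.mono fun x hx => ⟨hr.1.trans_le hx.1, hx.2⟩
    refine hGi.congr_ae ?_
    rw [uIoc_of_le hr.2.le, ← restrict_Ioo_eq_restrict_Ioc]
    filter_upwards [ae_restrict_mem measurableSet_Ioo] with x hx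
    exact (hgG ⟨hr.1.trans hx.1, hx.2⟩).symm
  have h := intervalIntegral.integral_hasDerivAt_left hint
    (hgc.stronglyMeasurableAtFilter isOpen_Ioo r hr) (hgc.continuousAt hnhds)
  refine h.congr_of_eventuallyEq ?_
  filter_upwards [hnhds] with t ht
  rw [intervalIntegral.integral_of_le ht.2.le]

open Set Filter Topology in
/-- The weighted flux `r ^ (N - 1) * |u'| ^ (p - 1)` of a solution of a radial `p`-Laplace
equation with positive right-hand side has the expected derivative, because `u' < 0`. -/
theorem hasDerivAt_radial_flux {N : ℕ} (hN : 2 ≤ N) {p R : ℝ} (hp : 1 < p) {u f : ℝ → ℝ}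
    (hu : ContDiffOn ℝ 1 u (Icc 0 R)) (hf : ∀ r ∈ Ioo 0 R, 0 < f r)
    (heq : ∀ r ∈ Ioo 0 R,
      deriv (fun s => s ^ ((N : ℝ) - 1) * |deriv u s| ^ (p - 2) * deriv u s) r
        = -(r ^ ((N : ℝ) - 1) * f r)) {r : ℝ} (hr : r ∈ Ioo 0 R) :
    HasDerivAt (fun t => t ^ ((N : ℝ) - 1) * |deriv u t| ^ (p - 1))
      (r ^ ((N : ℝ) - 1) * f r) r := by
  set w : ℝ → ℝ := fun s => s ^ ((N : ℝ) - 1) * |deriv u s| ^ (p - 2) * deriv u s with hw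
  have hR : 0 < R := hr.1.trans hr.2
  have hN1 : (0 : ℝ) < (N : ℝ) - 1 := by
    have : (2 : ℝ) ≤ N := by exact_mod_cast hN
    linarith
  have hflux : ∀ x : ℝ, |x| ^ (p - 2) * |x| = |x| ^ (p - 1) := by
    intro x
    rcases eq_or_ne x 0 with rfl | hx
    · rw [abs_zero, mul_zero, Real.zero_rpow (by linarith)]
    · rw [← Real.rpow_add_one (abs_ne_zero.2 hx)]
      congr 1
      ring
  have hneg : ∀ s ∈ Ioo 0 R, deriv w s < 0 := by
    intro s hs
    rw [heq s hs]
    exact neg_neg_of_pos (mul_pos (Real.rpow_pos_of_pos hs.1 _) (hf s hs))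
  have hdiff : ∀ s ∈ Ioo 0 R, DifferentiableAt ℝ w s := fun s hs =>
    differentiableAt_of_deriv_ne_zero (hneg s hs).ne
  have hanti : StrictAntiOn w (Ioo 0 R) := by
    refine strictAntiOn_of_deriv_neg (convex_Ioo 0 R)
      (fun s hs => (hdiff s hs).continuousAt.continuousWithinAt) ?_
    rwa [interior_Ioo]
  obtain ⟨C, hC⟩ := isCompact_Icc.exists_bound_of_continuousOn
    (hu.continuousOn_derivWithin (uniqueDiffOn_Icc hR) le_rfl)
  have hlim : Tendsto w (𝓝[>] 0) (𝓝 0) := by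
    have hpow : Tendsto (fun s : ℝ => s ^ ((N : ℝ) - 1) * C ^ (p - 1)) (𝓝[>] 0) (𝓝 0) := by
      have h := (Real.continuousAt_rpow_const (0 : ℝ) ((N : ℝ) - 1) (Or.inr hN1.le)).tendsto
      rw [Real.zero_rpow hN1.ne'] at h
      simpa using (h.mono_left nhdsWithin_le_nhds).mul_const (C ^ (p - 1))
    refine squeeze_zero_norm' ?_ hpow
    filter_upwards [Ioo_mem_nhdsGT hR] with s hs
    have hd : derivWithin u (Icc 0 R) s = deriv u s :=
      derivWithin_of_mem_nhds (Icc_mem_nhds hs.1 hs.2)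
    have hCs := hC s (Ioo_subset_Icc_self hs)
    rw [hd, Real.norm_eq_abs] at hCs
    have hs0 : 0 ≤ s ^ ((N : ℝ) - 1) := Real.rpow_nonneg hs.1.le _
    rw [Real.norm_eq_abs, hw, abs_mul, abs_mul, abs_of_nonneg hs0,
      abs_of_nonneg (Real.rpow_nonneg (abs_nonneg _) _), mul_assoc, hflux]
    exact mul_le_mul_of_nonneg_left
      (Real.rpow_le_rpow (abs_nonneg _) hCs (by linarith)) hs0
  have hwneg : ∀ t ∈ Ioo 0 R, w t < 0 := by
    intro t ht
    have ht2 : t / 2 ∈ Ioo 0 R := ⟨half_pos ht.1, (half_lt_self ht.1).trans ht.2⟩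
    have hle : w (t / 2) ≤ 0 := by
      refine ge_of_tendsto hlim ?_
      filter_upwards [Ioo_mem_nhdsGT ht2.1] with s hs
      exact (hanti ⟨hs.1, hs.2.trans ht2.2⟩ ht2 hs.2).le
    exact (hanti ht2 ht (half_lt_self ht.1)).trans_le hle
  have hder : HasDerivAt (fun t => -w t) (r ^ ((N : ℝ) - 1) * f r) r := by
    have h := (hdiff r hr).hasDerivAt.neg
    rwa [heq r hr, neg_neg] at h
  refine hder.congr_of_eventuallyEq ?_
  filter_upwards [isOpen_Ioo.mem_nhds hr] with t ht
  have hu' : deriv u t ≤ 0 := by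
    by_contra! h
    exact (hwneg t ht).not_ge (mul_nonneg
      (mul_nonneg (Real.rpow_nonneg ht.1.le _) (Real.rpow_nonneg (abs_nonneg _) _)) h.le)
  rw [← hflux]
  simp only [hw, abs_of_nonpos hu']
  ring

/-- Lemma 2.2: the Pohozaev-type energy identity on `(0,R)`. -/
theorem pohozaev_identity_R (N : ℕ) (hN : 2 ≤ N) (p q δ μ R k₂ : ℝ)
    (hδ : 0 < δ) (hμ : 0 < μ) (hR : 0 < R)
    (hcase : ((N : ℝ) / (N - 1) < p ∧ p ≤ q ∧ q ≤ 2 ∧ k₂ = p / (p - 1)) ∨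
             (2 ≤ p ∧ p ≤ q ∧ q < (N : ℝ) ∧
                k₂ = q + ((N : ℝ) - q) * (q - 2) / (q - 1)))
    (u v : ℝ → ℝ) (hsol : IsRadialSolution N p q δ μ R u v) :
    ∀ r ∈ Set.Ioo (0:ℝ) R,
      HasDerivAt (fun t =>
          t ^ ((N:ℝ) + k₂ - 2) * |deriv u t| ^ (p - 1) * |deriv v t| ^ (q - 1)
          - ((N:ℝ) / (δ + 1)) * t ^ ((N:ℝ) - 1) * |deriv u t| ^ (p - 1) *
              (∫ s in Set.Ioc t R, s ^ (k₂ - 2) * |deriv v s| ^ (q - 1))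
          - ((N:ℝ) / (μ + 1)) * t ^ ((N:ℝ) - 1) * |deriv v t| ^ (q - 1) *
              (∫ s in Set.Ioc t R, s ^ (k₂ - 2) * |deriv u s| ^ (p - 1))
          + t ^ (N:ℝ) * (∫ s in Set.Ioc t R, s ^ (k₂ - 2) * |deriv v s| ^ (q - 1) * v s ^ δ)
          + t ^ (N:ℝ) * (∫ s in Set.Ioc t R, s ^ (k₂ - 2) * |deriv u s| ^ (p - 1) * u s ^ μ))
        ((k₂ - N + (N:ℝ) / (δ + 1) + (N:ℝ) / (μ + 1)) * r ^ ((N:ℝ) + k₂ - 3) *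
              |deriv u r| ^ (p - 1) * |deriv v r| ^ (q - 1)
          - ((N:ℝ) / (δ + 1)) * r ^ ((N:ℝ) - 1) * v r ^ δ *
              (∫ s in Set.Ioc r R, s ^ (k₂ - 2) * |deriv v s| ^ (q - 1))
          + (N:ℝ) * r ^ ((N:ℝ) - 1) *
              (∫ s in Set.Ioc r R, s ^ (k₂ - 2) * |deriv v s| ^ (q - 1) * v s ^ δ)
          - ((N:ℝ) / (μ + 1)) * r ^ ((N:ℝ) - 1) * u r ^ μ *
              (∫ s in Set.Ioc r R, s ^ (k₂ - 2) * |deriv u s| ^ (p - 1))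
          + (N:ℝ) * r ^ ((N:ℝ) - 1) *
              (∫ s in Set.Ioc r R, s ^ (k₂ - 2) * |deriv u s| ^ (p - 1) * u s ^ μ)) r := by
  intro r hr
  obtain ⟨hu, hv, -, -, hupos, hvpos, -, -, -, -, hequ, heqv⟩ := hsol
  have hN2 : (2 : ℝ) ≤ N := by exact_mod_cast hN
  have hp : 1 < p := by
    rcases hcase with ⟨h, -⟩ | ⟨h, -⟩
    · exact ((one_lt_div (by linarith)).2 (by linarith)).trans h
    · linarith
  have hq : 1 < q := by
    rcases hcase with ⟨-, h, -⟩ | ⟨-, h, -⟩ <;> linarith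
  have hA := hasDerivAt_radial_flux hN hp (f := fun s => v s ^ δ) hu
    (fun s hs => Real.rpow_pos_of_pos (hvpos s (Set.Ioo_subset_Ico_self hs)) _)
    (fun s hs => hequ s (Set.Ioo_subset_Ioc_self hs)) hr
  have hB := hasDerivAt_radial_flux hN hq (f := fun s => u s ^ μ) hv
    (fun s hs => Real.rpow_pos_of_pos (hupos s (Set.Ioo_subset_Ico_self hs)) _)
    (fun s hs => heqv s (Set.Ioo_subset_Ioc_self hs)) hr
  have hweight : ∀ {w : ℝ → ℝ} {a : ℝ}, ContDiffOn ℝ 1 w (Set.Icc 0 R) → 1 < a →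
      Set.EqOn (fun s => s ^ (k₂ - 2) * |deriv w s| ^ (a - 1))
        (fun s => s ^ (k₂ - 2) * |derivWithin w (Set.Icc 0 R) s| ^ (a - 1)) (Set.Ioo 0 R) ∧
      ContinuousOn (fun s => s ^ (k₂ - 2) * |derivWithin w (Set.Icc 0 R) s| ^ (a - 1))
        (Set.Ioc 0 R) := by
    intro w a hw ha
    refine ⟨fun s hs => ?_, ?_⟩
    · simp only [derivWithin_of_mem_nhds (Icc_mem_nhds hs.1 hs.2)]
    · refine ContinuousOn.mul
        (fun s hs => (Real.continuousAt_rpow_const s _ (Or.inl hs.1.ne')).continuousWithinAt) ?_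
      exact (((hw.continuousOn_derivWithin (uniqueDiffOn_Icc hR) le_rfl).mono
        Set.Ioc_subset_Icc_self).abs).rpow_const fun s _ => Or.inr (by linarith)
  obtain ⟨hu₁, hu₂⟩ := hweight hu hp
  obtain ⟨hv₁, hv₂⟩ := hweight hv hq
  have hI₁ := hasDerivAt_setIntegral_Ioc_left hv₁ hv₂ hr
  have hI₂ := hasDerivAt_setIntegral_Ioc_left hu₁ hu₂ hr
  have hI₃ := hasDerivAt_setIntegral_Ioc_left
    (g := fun s => s ^ (k₂ - 2) * |deriv v s| ^ (q - 1) * v s ^ δ)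
    (fun s hs => congrArg (· * v s ^ δ) (hv₁ hs))
    (hv₂.mul ((hv.continuousOn.mono Set.Ioc_subset_Icc_self).rpow_const
      fun s _ => Or.inr hδ.le)) hr
  have hI₄ := hasDerivAt_setIntegral_Ioc_left
    (g := fun s => s ^ (k₂ - 2) * |deriv u s| ^ (p - 1) * u s ^ μ)
    (fun s hs => congrArg (· * u s ^ μ) (hu₁ hs))
    (hu₂.mul ((hu.continuousOn.mono Set.Ioc_subset_Icc_self).rpow_const
      fun s _ => Or.inr hμ.le)) hr
  have hP := Real.hasDerivAt_rpow_const (x := r) (p := k₂ - N) (Or.inl hr.1.ne')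
  have hQ := Real.hasDerivAt_rpow_const (x := r) (p := (N : ℝ)) (Or.inl hr.1.ne')
  have hE := (((((hP.mul hA).mul hB).sub ((hA.mul hI₁).const_mul ((N : ℝ) / (δ + 1)))).sub
    ((hB.mul hI₂).const_mul ((N : ℝ) / (μ + 1)))).add (hQ.mul hI₃)).add (hQ.mul hI₄)
  refine (hE.congr_of_eventuallyEq ?_).congr_deriv ?_
  · filter_upwards [isOpen_Ioo.mem_nhds hr] with t ht
    have hsplit : t ^ ((N : ℝ) + k₂ - 2)
        = t ^ (k₂ - N) * t ^ ((N : ℝ) - 1) * t ^ ((N : ℝ) - 1) := by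
      rw [← Real.rpow_add ht.1, ← Real.rpow_add ht.1]
      congr 1
      ring
    simp only [Pi.add_apply, Pi.sub_apply, Pi.mul_apply, hsplit]
    ring
  · have h₁ : r ^ ((N : ℝ) - 1) = r ^ (N : ℝ) / r := Real.rpow_sub_one hr.1.ne' _
    have h₂ : r ^ (k₂ - N - 1) = r ^ k₂ / r ^ (N : ℝ) / r := by
      rw [Real.rpow_sub_one hr.1.ne', Real.rpow_sub hr.1]
    have h₃ : r ^ (k₂ - N) = r ^ k₂ / r ^ (N : ℝ) := Real.rpow_sub hr.1 _ _
    have h₄ : r ^ (k₂ - 2) = r ^ k₂ / r ^ 2 := by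
      exact_mod_cast Real.rpow_sub_natCast hr.1.ne' k₂ 2
    have h₅ : r ^ ((N : ℝ) + k₂ - 3) = r ^ (N : ℝ) * r ^ k₂ / r ^ 3 := by
      rw [← Real.rpow_add hr.1]
      exact_mod_cast Real.rpow_sub_natCast hr.1.ne' ((N : ℝ) + k₂) 3
    have hr0 : r ≠ 0 := hr.1.ne'
    have hrN : r ^ (N : ℝ) ≠ 0 := (Real.rpow_pos_of_pos hr.1 _).ne'
    have hδ1 : δ + 1 ≠ 0 := by positivity
    have hμ1 : μ + 1 ≠ 0 := by positivity
    simp only [Pi.mul_apply, h₁, h₂, h₃, h₄, h₅]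
    generalize r ^ (N : ℝ) = X at *
    generalize r ^ k₂ = K at *
    generalize (∫ s in Set.Ioc r R, s ^ (k₂ - 2) * |deriv v s| ^ (q - 1)) = J₁
    generalize (∫ s in Set.Ioc r R, s ^ (k₂ - 2) * |deriv u s| ^ (p - 1)) = J₂
    field_simp
    ring
end

section
/- Let N ≥ 2 be an integer, 1 < p ≤ 2, μ > 0, and set k = p + (N−p)(p−2)/(p−1). Let u be a real function on (0,∞), continuously differentiable, with u(r) > 0 and u'(r) < 0 for all r > 0, u(r) → 0 as r → ∞, such that r ↦ r^{N−1}|u'(r)|^{p−1} is nondecreasing on (0,∞) and s ↦ s^{k−2}|u'(s)|^{p−1} is integrable on (1,∞). Then for every r > 0, G(r) := N ∫_r^∞ s^{k−2}|u'(s)|^{p−1} u(s)^μ ds − (N/(μ+1)) u(r)^μ ∫_r^∞ s^{k−2}|u'(s)|^{p−1} ds ≥ 0. -/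
open MeasureTheory

/-- The weight `s ^ (k - 2) * d ^ (p - 1)` equals `d` times a nonpositive power of the flux
`s ^ (N - 1) * d ^ (p - 1)`. -/
lemma weight_eq_flux_rpow_mul {N p k s d : ℝ} (hp1 : 1 < p)
    (hk : k = p + (N - p) * (p - 2) / (p - 1)) (hs : 0 < s) (hd : 0 < d) :
    s ^ (k - 2) * d ^ (p - 1) =
      (s ^ (N - 1) * d ^ (p - 1)) ^ ((p - 2) / (p - 1)) * d := by
  have hq : p - 1 ≠ 0 := by linarith
  rw [Real.mul_rpow (by positivity) (by positivity), ← Real.rpow_mul hs.le,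
    ← Real.rpow_mul hd.le, mul_assoc, ← Real.rpow_add_one hd.ne']
  have h1 : k - 2 = (N - 1) * ((p - 2) / (p - 1)) := by
    rw [hk]; field_simp; ring
  have h2 : (p - 1) * ((p - 2) / (p - 1)) + 1 = p - 1 := by
    field_simp; ring
  rw [h1, h2]

/-- A continuous function tending to `0` at infinity attains on `(r, ∞)` every value strictly
between `0` and its value at `r`. -/
lemma exists_gt_eq_of_tendsto_zero {g : ℝ → ℝ} {r c : ℝ} (hg : ContinuousOn g (Set.Ici r))
    (hlim : Filter.Tendsto g Filter.atTop (nhds 0)) (hc0 : 0 < c) (hc : c < g r) :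
    ∃ x, r < x ∧ g x = c := by
  obtain ⟨M, hM, hrM⟩ :=
    ((hlim.eventually (gt_mem_nhds hc0)).and (Filter.eventually_gt_atTop r)).exists
  obtain ⟨x, hx, hxc⟩ := intermediate_value_Icc' hrM.le
    (hg.mono Set.Icc_subset_Ici_self) ⟨hM.le, hc.le⟩
  refine ⟨x, hx.1.lt_of_ne ?_, hxc⟩
  rintro rfl
  exact hc.ne' hxc

/-- Nonnegativity of the quantity `G(p,μ,u)` in the subquadratic case. -/
theorem G_nonneg (N : ℕ) (hN : 2 ≤ N) (p μ k : ℝ) (hp1 : 1 < p) (hp2 : p ≤ 2)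
    (hμ : 0 < μ) (hk : k = p + ((N : ℝ) - p) * (p - 2) / (p - 1))
    (u : ℝ → ℝ) (hu : ContDiffOn ℝ 1 u (Set.Ioi 0))
    (hupos : ∀ r : ℝ, 0 < r → 0 < u r)
    (hu' : ∀ r : ℝ, 0 < r → deriv u r < 0)
    (hlim : Filter.Tendsto u Filter.atTop (nhds 0))
    (hmono : MonotoneOn (fun r => r ^ ((N:ℝ) - 1) * |deriv u r| ^ (p - 1)) (Set.Ioi 0))
    (hint : IntegrableOn (fun s => s ^ (k - 2) * |deriv u s| ^ (p - 1)) (Set.Ioi 1)) :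
    ∀ r : ℝ, 0 < r →
      0 ≤ (N:ℝ) * (∫ s in Set.Ioi r, s ^ (k - 2) * |deriv u s| ^ (p - 1) * u s ^ μ)
        - ((N:ℝ) / (μ + 1)) * u r ^ μ *
            (∫ s in Set.Ioi r, s ^ (k - 2) * |deriv u s| ^ (p - 1)) := by
  intro r hr
  have hd : ∀ s, 0 < s → HasDerivAt u (deriv u s) s := fun s hs =>
    ((hu.differentiableOn one_ne_zero).differentiableAt (Ioi_mem_nhds hs)).hasDerivAt
  have hdc : ContinuousOn (deriv u) (Set.Ioi 0) :=
    hu.continuousOn_deriv_of_isOpen isOpen_Ioi le_rfl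
  have hpos : ∀ s ∈ Set.Ioi r, 0 < s := fun s hs => hr.trans hs
  have hanti : StrictAntiOn u (Set.Ioi 0) := by
    refine strictAntiOn_of_deriv_neg (convex_Ioi 0) hu.continuousOn ?_
    rw [interior_Ioi]
    exact fun s hs => hu' s hs
  set f : ℝ → ℝ := fun s => s ^ (k - 2) * |deriv u s| ^ (p - 1) with hf
  set g : ℝ → ℝ := fun s => u s ^ μ
  have hfc : ContinuousOn f (Set.Ioi 0) := by
    refine ContinuousOn.mul ?_ ?_
    · exact continuousOn_id.rpow_const fun s hs => Or.inl (ne_of_gt hs)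
    · exact hdc.abs.rpow_const fun s hs => Or.inl (abs_pos.2 (hu' s hs).ne).ne'
  have hgc : ContinuousOn g (Set.Ioi 0) :=
    hu.continuousOn.rpow_const fun s hs => Or.inl (hupos s hs).ne'
  have hfint : IntegrableOn f (Set.Ioi r) := by
    have h1 : IntegrableOn f (Set.Icc r 1) :=
      (hfc.mono fun s hs => hr.trans_le hs.1).integrableOn_Icc
    refine (h1.union hint).mono_set fun s hs => ?_
    rcases le_or_gt s 1 with h | h
    · exact Or.inl ⟨le_of_lt hs, h⟩
    · exact Or.inr h
  have hd' : IntegrableOn (deriv u) (Set.Ioi r) :=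
    integrableOn_Ioi_deriv_of_nonpos (hd r hr).continuousAt.continuousWithinAt
      (fun s hs => hd s (hpos s hs)) (fun s hs => (hu' s (hpos s hs)).le) hlim
  have hgm : AEStronglyMeasurable g (volume.restrict (Set.Ioi r)) :=
    (hgc.mono fun s hs => hpos s hs).aestronglyMeasurable measurableSet_Ioi
  have hgb : ∀ᵐ s ∂(volume.restrict (Set.Ioi r)), ‖g s‖ ≤ u r ^ μ := by
    refine (ae_restrict_iff' measurableSet_Ioi).2 (Filter.Eventually.of_forall fun s hs => ?_)
    have h0 := hupos s (hpos s hs)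
    rw [Real.norm_of_nonneg (Real.rpow_nonneg h0.le _)]
    exact Real.rpow_le_rpow h0.le (hanti hr (hpos s hs) hs).le hμ.le
  have hfg : IntegrableOn (fun s => f s * g s) (Set.Ioi r) := hfint.mul_bdd hgm hgb
  have hdg : IntegrableOn (fun s => deriv u s * g s) (Set.Ioi r) := hd'.mul_bdd hgm hgb
  have hUpos : 0 < u r ^ μ := Real.rpow_pos_of_pos (hupos r hr) _
  set c : ℝ := u r ^ μ / (μ + 1) with hc
  have hglim : Filter.Tendsto g Filter.atTop (nhds 0) := by
    simpa [Real.zero_rpow hμ.ne'] using hlim.rpow_const (Or.inr hμ.le)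
  obtain ⟨x, hrx, hx⟩ : ∃ x, r < x ∧ g x = c :=
    exists_gt_eq_of_tendsto_zero (hgc.mono fun s hs => hr.trans_le hs) hglim (by positivity)
      (div_lt_self hUpos (by linarith))
  have hx0 : 0 < x := hr.trans hrx
  have hzero : ∫ s in Set.Ioi r, (deriv u s * g s - deriv u s * c) = 0 := by
    have hF : ∀ s ∈ Set.Ici r, HasDerivAt (fun s => u s ^ (μ + 1) / (μ + 1) - u s * c)
        (deriv u s * g s - deriv u s * c) s := by
      intro s hs
      have hs0 : 0 < s := hr.trans_le hs
      have h := (((hd s hs0).rpow_const (p := μ + 1)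
        (Or.inl (hupos s hs0).ne')).div_const (μ + 1)).sub ((hd s hs0).mul_const c)
      refine h.congr_deriv ?_
      rw [add_sub_cancel_right]
      field_simp
      rfl
    have hFlim : Filter.Tendsto (fun s => u s ^ (μ + 1) / (μ + 1) - u s * c)
        Filter.atTop (nhds 0) := by
      have h := ((hlim.rpow_const (p := μ + 1) (Or.inr (by linarith))).div_const (μ + 1)).sub
        (hlim.mul_const c)
      simpa [Real.zero_rpow (by linarith : μ + 1 ≠ 0)] using h
    rw [integral_Ioi_of_hasDerivAt_of_tendsto' hF (hdg.sub (hd'.mul_const c)) hFlim, hc,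
      Real.rpow_add_one (hupos r hr).ne']
    ring
  set w : ℝ → ℝ := fun s => s ^ ((N : ℝ) - 1) * |deriv u s| ^ (p - 1) with hw
  set e : ℝ := (p - 2) / (p - 1)
  have he : e ≤ 0 := div_nonpos_of_nonpos_of_nonneg (by linarith) (by linarith)
  have hwpos : ∀ s, 0 < s → 0 < w s := fun s hs =>
    mul_pos (Real.rpow_pos_of_pos hs _) (Real.rpow_pos_of_pos (abs_pos.2 (hu' s hs).ne) _)
  have hfw : ∀ s, 0 < s → f s = w s ^ e * (-deriv u s) := fun s hs => by
    have h := weight_eq_flux_rpow_mul hp1 hk hs (abs_pos.2 (hu' s hs).ne)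
    simp only [hf, hw, h, abs_of_neg (hu' s hs), e]
  have key : ∀ s ∈ Set.Ioi r,
      (-(w x ^ e)) * (deriv u s * g s - deriv u s * c) ≤ f s * g s - f s * c := by
    intro s hs
    have hs0 := hpos s hs
    rw [hfw s hs0]
    suffices h : 0 ≤ (w s ^ e - w x ^ e) * (g s - c) by
      nlinarith [mul_nonneg h (neg_pos.2 (hu' s hs0)).le]
    rw [← hx]
    rcases le_total s x with h | h
    · exact mul_nonneg
        (sub_nonneg.2 (Real.rpow_le_rpow_of_nonpos (hwpos s hs0) (hmono hs0 hx0 h) he))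
        (sub_nonneg.2 (Real.rpow_le_rpow (hupos x hx0).le (hanti.antitoneOn hs0 hx0 h) hμ.le))
    · exact mul_nonneg_of_nonpos_of_nonpos
        (sub_nonpos.2 (Real.rpow_le_rpow_of_nonpos (hwpos x hx0) (hmono hx0 hs0 h) he))
        (sub_nonpos.2 (Real.rpow_le_rpow (hupos s hs0).le (hanti.antitoneOn hx0 hs0 h) hμ.le))
  have hle := setIntegral_mono_on ((hdg.sub (hd'.mul_const c)).const_mul (-(w x ^ e)))
    (hfg.sub (hfint.mul_const c)) measurableSet_Ioi key
  simp only [Pi.sub_apply] at hle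
  rw [integral_const_mul, hzero, mul_zero, integral_sub hfg (hfint.mul_const c),
    integral_mul_const] at hle
  have hfin := mul_nonneg (Nat.cast_nonneg (α := ℝ) N) hle
  calc (0 : ℝ) ≤ _ := hfin
    _ = _ := by rw [hc]; ring
end

section
/- Let N ≥ 2 be an integer, 1 < p ≤ 2, and set k = p + (N−p)(p−2)/(p−1), so that k − 2 = (N−1)(p−2)/(p−1). Let u be a continuously differentiable real function on (0,∞) with u(r) > 0 and u'(r) < 0 for all r > 0, u(r) → 0 as r → ∞, and such that r ↦ r^{N−1}|u'(r)|^{p−1} is nondecreasing on (0,∞). Then for every r > 0, ∫_r^∞ s^{k−2}|u'(s)|^{p−1} ds ≤ r^{k−2} u(r) |u'(r)|^{p−2}. -/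
open MeasureTheory

/-- The key integral estimate `∫_r^∞ s^{k-2}|u'|^{p-1} ds ≤ r^{k-2} u(r) |u'(r)|^{p-2}`
in the subquadratic case. -/
theorem integral_estimate (N : ℕ) (hN : 2 ≤ N) (p k : ℝ) (hp1 : 1 < p) (hp2 : p ≤ 2)
    (hk : k = p + ((N : ℝ) - p) * (p - 2) / (p - 1))
    (hk' : k - 2 = ((N : ℝ) - 1) * (p - 2) / (p - 1))
    (u : ℝ → ℝ) (hu : ContDiffOn ℝ 1 u (Set.Ioi 0))
    (hupos : ∀ r : ℝ, 0 < r → 0 < u r)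
    (hu' : ∀ r : ℝ, 0 < r → deriv u r < 0)
    (hlim : Filter.Tendsto u Filter.atTop (nhds 0))
    (hmono : MonotoneOn (fun r => r ^ ((N:ℝ) - 1) * |deriv u r| ^ (p - 1)) (Set.Ioi 0)) :
    ∀ r : ℝ, 0 < r →
      (∫ s in Set.Ioi r, s ^ (k - 2) * |deriv u s| ^ (p - 1))
        ≤ r ^ (k - 2) * u r * |deriv u r| ^ (p - 2) := by
  intro r hr
  have hp : p - 1 ≠ 0 := (sub_pos.2 hp1).ne'
  have hderiv : ∀ s ∈ Set.Ici r, HasDerivAt u (deriv u s) s := fun s hs =>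
    ((hu.differentiableOn one_ne_zero).differentiableAt
      (Ioi_mem_nhds (hr.trans_le hs))).hasDerivAt
  have hneg : ∀ s ∈ Set.Ioi r, deriv u s ≤ 0 := fun s hs => (hu' s (hr.trans hs)).le
  have hint : IntegrableOn (deriv u) (Set.Ioi r) :=
    integrableOn_Ioi_deriv_of_nonpos' hderiv hneg hlim
  have hval : ∫ s in Set.Ioi r, deriv u s = 0 - u r :=
    integral_Ioi_of_hasDerivAt_of_nonpos' hderiv hneg hlim
  have hpow : ∀ s : ℝ, 0 < s →
      (s ^ ((N : ℝ) - 1) * |deriv u s| ^ (p - 1)) ^ ((p - 2) / (p - 1))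
        = s ^ (k - 2) * |deriv u s| ^ (p - 2) := by
    intro s hs
    rw [Real.mul_rpow (by positivity) (by positivity), ← Real.rpow_mul hs.le,
      ← Real.rpow_mul (abs_nonneg _), hk', mul_div_cancel₀ _ hp, mul_div_assoc]
  have hanti : ∀ s ∈ Set.Ioi r, s ^ (k - 2) * |deriv u s| ^ (p - 2)
      ≤ r ^ (k - 2) * |deriv u r| ^ (p - 2) := by
    intro s hs
    rw [← hpow s (hr.trans hs), ← hpow r hr]
    have hur : 0 < |deriv u r| := abs_pos.2 (hu' r hr).ne
    exact Real.rpow_le_rpow_of_nonpos (by positivity)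
      (hmono hr (hr.trans hs) (le_of_lt hs))
      (div_nonpos_of_nonpos_of_nonneg (by linarith) (by linarith))
  calc (∫ s in Set.Ioi r, s ^ (k - 2) * |deriv u s| ^ (p - 1))
      ≤ ∫ s in Set.Ioi r, r ^ (k - 2) * |deriv u r| ^ (p - 2) * -deriv u s := by
        refine integral_mono_of_nonneg ?_ (hint.neg.const_mul _) ?_
        · filter_upwards [ae_restrict_mem measurableSet_Ioi] with s hs
          have hs0 : 0 < s := hr.trans hs
          simp only [Pi.zero_apply]
          positivity
        · filter_upwards [ae_restrict_mem measurableSet_Ioi] with s hs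
          have hus : deriv u s < 0 := hu' s (hr.trans hs)
          have hsplit : |deriv u s| ^ (p - 1) = |deriv u s| ^ (p - 2) * -deriv u s := by
            rw [show p - 1 = (p - 2) + 1 by ring, Real.rpow_add_one (abs_pos.2 hus.ne).ne',
              abs_of_neg hus]
          simp only [hsplit, ← mul_assoc]
          exact mul_le_mul_of_nonneg_right (hanti s hs) (by linarith)
    _ = r ^ (k - 2) * u r * |deriv u r| ^ (p - 2) := by
        rw [integral_const_mul, integral_neg, hval]
        ring
end

section
/- Let N ≥ 2 be an integer and let p, q, δ, μ be reals with 2N/(N+1) < p ≤ q ≤ 2, δ, μ > 0, δμ − (p−1)(q−1) > 0, and 1/(δ+1) + 1/(μ+1) > (N − p)/(N(p−1)). Set k₁ = p + (N−p)(p−2)/(p−1) and L = N + k₁ − p − q. Then L < (q−1)(L+p)/(δ+q−1) + (p−1)(L+q)/(μ+p−1). -/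
/-- A convexity bound for `x ↦ x / (1 - e x)` at the points `1 / P` and `1 / Q`. -/
lemma two_mul_div_le_one_div_sub_add_one_div_sub {e P Q : ℝ} (he : 0 ≤ e) (hP : e < P)
    (hQ : e < Q) :
    2 * (1 / P + 1 / Q) / (2 - e * (1 / P + 1 / Q)) ≤ 1 / (P - e) + 1 / (Q - e) := by
  have hP0 : 0 < P := he.trans_lt hP
  have hQ0 : 0 < Q := he.trans_lt hQ
  have hPe : 0 < P - e := sub_pos.2 hP
  have hQe : 0 < Q - e := sub_pos.2 hQ
  have hD : 0 < 2 * (P * Q) - e * (P + Q) := by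
    nlinarith [mul_pos hPe hQ0, mul_pos hQe hP0]
  have hden : 2 - e * (1 / P + 1 / Q) = (2 * (P * Q) - e * (P + Q)) / (P * Q) := by
    field_simp
    ring
  have hl : 2 * (1 / P + 1 / Q) / (2 - e * (1 / P + 1 / Q))
      = 2 * (P + Q) / (2 * (P * Q) - e * (P + Q)) := by
    rw [hden]
    field_simp
    ring
  have hr : 1 / (P - e) + 1 / (Q - e) = (P + Q - 2 * e) / ((P - e) * (Q - e)) := by
    field_simp
    ring
  rw [hl, hr, div_le_div_iff₀ hD (mul_pos hPe hQe)]
  nlinarith [mul_nonneg he (sq_nonneg (P - Q))]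

/-- The case of equal exponents `p = q = a + 1` in dimension `n + 1`. -/
lemma lt_mul_one_div_add_one_div {n a δ μ : ℝ} (hn : 1 ≤ n) (ha1 : a ≤ 1)
    (ha : n < (n + 2) * a) (hδ : 0 < δ) (hμ : 0 < μ)
    (h : (n - a) / ((n + 1) * a) < 1 / (δ + 1) + 1 / (μ + 1)) :
    (2 * a - 1) * (n - a) < a * (a * (2 * n + 2) - n - a ^ 2) * (1 / (δ + a) + 1 / (μ + a)) := by
  have ha0 : 0 < a := by
    by_contra! h0
    nlinarith
  have hB : 0 < a * (2 * n + 2) - n - a ^ 2 := by nlinarith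
  rcases le_or_gt ((2 * a - 1) * (n - a)) 0 with hK | hK
  · exact hK.trans_lt (by positivity)
  have hna : 0 < n - a := by
    rcases (sub_nonneg.2 (ha1.trans hn)).lt_or_eq with h0 | h0
    · exact h0
    · simp [← h0] at hK
  have key := two_mul_div_le_one_div_sub_add_one_div_sub (e := 1 - a) (P := δ + 1) (Q := μ + 1)
    (by linarith) (by linarith) (by linarith)
  rw [show δ + 1 - (1 - a) = δ + a by ring, show μ + 1 - (1 - a) = μ + a by ring] at key
  have ht2 : 1 / (δ + 1) + 1 / (μ + 1) < 2 := by
    linarith [(div_lt_one (by linarith)).2 (by linarith : 1 < δ + 1),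
      (div_lt_one (by linarith)).2 (by linarith : 1 < μ + 1)]
  have ht0 : 0 < 1 / (δ + 1) + 1 / (μ + 1) := by positivity
  generalize 1 / (δ + 1) + 1 / (μ + 1) = t at h key ht0 ht2
  have hden : 0 < 2 - (1 - a) * t := by nlinarith
  refine lt_of_lt_of_le ?_ (mul_le_mul_of_nonneg_left key (mul_pos ha0 hB).le)
  rw [mul_div_assoc', lt_div_iff₀ hden]
  rw [div_lt_iff₀ (by positivity)] at h
  have hcoef : 0 < 2 * a * (a * (2 * n + 2) - n - a ^ 2) + (2 * a - 1) * (n - a) * (1 - a) := by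
    have := mul_nonneg hK.le (sub_nonneg.2 ha1)
    positivity
  have hpoly : 0 ≤ (n - a) * ((1 - a) * (n * (2 * a - 1) + 3 * a)) :=
    mul_nonneg hna.le (mul_nonneg (sub_nonneg.2 ha1) (by nlinarith))
  have hlin := mul_lt_mul_of_pos_left h hcoef
  have hna1 : 0 < (n + 1) * a := by positivity
  refine lt_of_mul_lt_mul_left ?_ hna1.le
  linarith

/-- The algebraic inequality (2.9) in the subquadratic case, guaranteeing
`E₁(∞) = 0`. -/
theorem algebraic_ineq_sub (N : ℕ) (hN : 2 ≤ N) (p q δ μ : ℝ)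
    (hδ : 0 < δ) (hμ : 0 < μ)
    (hp : 2 * (N : ℝ) / (N + 1) < p) (hpq : p ≤ q) (hq : q ≤ 2)
    (hd : 0 < δ * μ - (p - 1) * (q - 1))
    (hineq : 1 / (δ + 1) + 1 / (μ + 1) > ((N : ℝ) - p) / (N * (p - 1))) :
    let k₁ := p + ((N : ℝ) - p) * (p - 2) / (p - 1)
    let L := (N : ℝ) + k₁ - p - q
    L < (q - 1) * (L + p) / (δ + q - 1) + (p - 1) * (L + q) / (μ + p - 1) := by
  intro k₁ L
  have hN' : (2 : ℝ) ≤ N := by exact_mod_cast hN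
  rw [div_lt_iff₀ (by linarith)] at hp
  have hp1 : 0 < p - 1 := by
    by_contra! h0
    nlinarith
  have hq1 : 0 < q - 1 := by linarith
  have main := lt_mul_one_div_add_one_div (n := N - 1) (a := p - 1) (by linarith) (by linarith)
    (by linarith) hδ hμ (by convert hineq.lt using 2 <;> ring)
  set A : ℝ := 2 * N - (N - 1) / (p - 1) with hA
  have hAp : (p - 1) * A = 2 * N * (p - 1) - (N - 1) := by
    rw [hA]
    field_simp
  have hL : L = A + 1 - p - q := by
    simp only [L, k₁, hA]
    field_simp
    ring
  have hA0 : 0 < A := by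
    refine pos_of_mul_pos_right (a := p - 1) ?_ hp1.le
    nlinarith
  have hδq : 0 < δ + q - 1 := by linarith
  have hδp : 0 < δ + p - 1 := by linarith
  have hμp : 0 < μ + p - 1 := by linarith
  have mono : (p - 1) * (A + δ) / (δ + p - 1) ≤ (q - 1) * (A + δ) / (δ + q - 1) := by
    rw [div_le_div_iff₀ hδp hδq]
    nlinarith [mul_nonneg (mul_nonneg hδ.le (add_pos hA0 hδ).le) (sub_nonneg.2 hpq)]
  have e1 : (q - 1) * (L + p) / (δ + q - 1) = (q - 1) * (A + δ) / (δ + q - 1) - (q - 1) := by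
    rw [hL]
    field_simp
    ring
  have e2 : (p - 1) * (A + δ) / (δ + p - 1)
      = (p - 1) + (p - 1) * (A - (p - 1)) * (1 / (δ + (p - 1))) := by
    rw [← add_sub_assoc]
    field_simp
    ring
  have e3 : (p - 1) * (L + q) / (μ + p - 1) = (p - 1) * (A - (p - 1)) * (1 / (μ + (p - 1))) := by
    rw [hL, ← add_sub_assoc]
    field_simp
    ring
  have hsub : A + 1 - 2 * p <
      (p - 1) * (A - (p - 1)) * (1 / (δ + (p - 1)) + 1 / (μ + (p - 1))) := by
    refine lt_of_mul_lt_mul_left ?_ hp1.le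
    generalize 1 / (δ + (p - 1)) + 1 / (μ + (p - 1)) = w at main ⊢
    clear_value A
    linear_combination main + (1 - (p - 1) * w) * hAp
  rw [e1, e3, hL]
  rw [e2] at mono
  linarith
end

section
/- Let N ≥ 2 be an integer and let p, q, δ, μ be reals with 2 ≤ p ≤ q < N, δ, μ > 0, δμ − (p−1)(q−1) > 0, and 1/(δ+1) + 1/(μ+1) > (N(q−1) − q)/(N(q−1)). Set k₁ = q/(q−1) and L = N + k₁ − p − q. Then L < (q−1)(L+p)/(δ+q−1) + (p−1)(L+q)/(μ+p−1). -/
/-- The algebraic inequality (2.9) in the superquadratic case, guaranteeing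
`E₁(∞) = 0`. -/
theorem algebraic_ineq_super (N : ℕ) (hN : 2 ≤ N) (p q δ μ : ℝ)
    (hδ : 0 < δ) (hμ : 0 < μ)
    (hp : 2 ≤ p) (hpq : p ≤ q) (hq : q < (N : ℝ))
    (hd : 0 < δ * μ - (p - 1) * (q - 1))
    (hineq : 1 / (δ + 1) + 1 / (μ + 1) > ((N : ℝ) * (q - 1) - q) / (N * (q - 1))) :
    let k₁ := q / (q - 1)
    let L := (N : ℝ) + k₁ - p - q
    L < (q - 1) * (L + p) / (δ + q - 1) + (p - 1) * (L + q) / (μ + p - 1) := by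
  intro k₁ L
  obtain ⟨a, rfl⟩ : ∃ a, p = a + 1 := ⟨p - 1, by ring⟩
  obtain ⟨b, rfl⟩ : ∃ b, q = b + 1 := ⟨q - 1, by ring⟩
  have ha : 1 ≤ a := by linarith
  have hb : 1 ≤ b := by linarith
  have ha0 : 0 < a := by linarith
  have hb0 : 0 < b := by linarith
  have hab : 1 ≤ a * b := one_le_mul_of_one_le_of_one_le ha hb
  have hN0 : (0 : ℝ) < N := by linarith
  simp only [add_sub_cancel_right] at hd hineq
  have h_num : N * b * (δ * μ - 1) < (1 + b) * ((1 + δ) * (1 + μ)) := by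
    rw [gt_iff_lt, div_add_div _ _ (by positivity) (by positivity),
      div_lt_div_iff₀ (by positivity) (by positivity)] at hineq
    linarith
  have h_le : N * b * (δ * μ - a * b) ≤ N * b * (δ * μ - 1) := by gcongr
  have h_poly : (1 + b) * ((1 + δ) * (1 + μ)) + (δ * μ - a * b) ≤
      b * ((δ + b) * (μ + a) + b * δ * (μ + a) + a * μ * (δ + b)) := by
    have hbb : 1 ≤ b * b := one_le_mul_of_one_le_of_one_le hb hb
    have h₁ : 0 ≤ (b * a + b * b - 2) * (δ * μ) := mul_nonneg (by linarith) (by positivity)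
    have h₂ : b ≤ a * b * b := by nlinarith
    have h₃ : 0 ≤ (a * b + a * b * b - 1 - b) * δ := mul_nonneg (by linarith) hδ.le
    have h₄ : b ≤ b * b * a := by linarith
    have h₅ : 0 ≤ (b * b + b * b * a - 1 - b) * μ := mul_nonneg (by linarith) hμ.le
    linarith
  have h_main : (N * b + 1) * (δ * μ - a * b) <
      b * ((δ + b) * (μ + a) + b * δ * (μ + a) + a * μ * (δ + b)) := by linarith
  have h_diff : b * (N + 1 / b - b) / (δ + b) + a * (N + 1 / b - a) / (μ + a) -
      (N + 1 / b - 1 - a - b) =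
      (b * ((δ + b) * (μ + a) + b * δ * (μ + a) + a * μ * (δ + b)) -
        (N * b + 1) * (δ * μ - a * b)) / (b * (δ + b) * (μ + a)) := by
    field_simp
    ring
  have h_pos : 0 < b * (N + 1 / b - b) / (δ + b) + a * (N + 1 / b - a) / (μ + a) -
      (N + 1 / b - 1 - a - b) := by
    rw [h_diff]
    exact div_pos (by linarith) (by positivity)
  have hL : L = N + 1 / b - 1 - a - b := by
    simp only [L, k₁, add_sub_cancel_right]
    field_simp
    ring
  rw [hL]
  convert sub_pos.mp h_pos using 3 <;> ring
end

section
/- Let N > 2 be an integer and let p, q, δ, μ be reals with 2 ≤ p ≤ q < N, q > 2, δ, μ > 0, δμ − (p−1)(q−1) > 0, and 1/(δ+1) + 1/(μ+1) ≤ (N − q)/(N(q−1)). Set k₂ = q + (N−q)(q−2)/(q−1) and L = N + k₂ − p − q. Then L > (q−1)(L+p)/(δ+q−1) + (p−1)(L+q)/(μ+p−1). -/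
/-- The concave map `x ↦ x / (1 + m x)` lies below its tangent line at `t`. -/
lemma div_one_add_mul_le_tangent {m t x : ℝ} (hm : 0 ≤ m) (ht : 0 ≤ t) (hx : 0 ≤ x) :
    x / (1 + m * x) ≤ (x + m * t ^ 2) / (1 + m * t) ^ 2 := by
  rw [div_le_div_iff₀ (by positivity) (by positivity)]
  nlinarith [mul_nonneg hm (sq_nonneg (x - t))]

lemma div_add_div_le_of_add_le {m c x y : ℝ} (hm : 0 ≤ m) (hx : 0 ≤ x) (hy : 0 ≤ y)
    (h : x + y ≤ c) :
    x / (1 + m * x) + y / (1 + m * y) ≤ 2 * c / (2 + m * c) := by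
  have hc : 0 ≤ c := by linarith
  have hpos : 0 < 1 + m * (c / 2) := by positivity
  calc x / (1 + m * x) + y / (1 + m * y)
      ≤ (x + m * (c / 2) ^ 2) / (1 + m * (c / 2)) ^ 2
          + (y + m * (c / 2) ^ 2) / (1 + m * (c / 2)) ^ 2 :=
        add_le_add (div_one_add_mul_le_tangent hm (by positivity) hx)
          (div_one_add_mul_le_tangent hm (by positivity) hy)
    _ = (x + y + 2 * m * (c / 2) ^ 2) / (1 + m * (c / 2)) ^ 2 := by ring
    _ ≤ (c + 2 * m * (c / 2) ^ 2) / (1 + m * (c / 2)) ^ 2 := by gcongr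
    _ = 2 * c / (2 + m * c) := by
        have : 0 < 2 + m * c := by positivity
        field_simp

lemma one_div_add_sub_one_eq {δ q : ℝ} (hδ : 0 < δ) (hq : 1 < q) :
    1 / (δ + q - 1) = 1 / (δ + 1) / (1 + (q - 2) * (1 / (δ + 1))) := by
  have h1 : 0 < δ + q - 1 := by linarith
  have h2 : 1 + (q - 2) * (1 / (δ + 1)) = (δ + q - 1) / (δ + 1) := by
    field_simp
    ring
  rw [h2]
  field_simp

/-- Replacing `p` by a larger `q` only increases `p + (p - 1) (A + q - p) / (μ + p - 1)`. -/
lemma add_mul_div_le_of_le {A μ p q : ℝ} (hA : 0 ≤ A) (hμ : 0 < μ) (hp : 1 < p) (hpq : p ≤ q) :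
    (p - 1) * (A + q - p) / (μ + p - 1) + p ≤ (q - 1) * A / (μ + q - 1) + q := by
  have h1 : 0 < μ + p - 1 := by linarith
  have h2 : 0 < μ + q - 1 := by linarith
  have key : (q - 1) * A / (μ + q - 1) + q - ((p - 1) * (A + q - p) / (μ + p - 1) + p)
      = (q - p) * (A * μ + μ * (μ + q - 1)) / ((μ + q - 1) * (μ + p - 1)) := by
    field_simp
    ring
  have : 0 ≤ (q - p) * (A * μ + μ * (μ + q - 1)) / ((μ + q - 1) * (μ + p - 1)) := by
    have : 0 ≤ q - p := by linarith
    positivity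
  linarith

/-- The reverse algebraic inequality (2.16) in the superquadratic case, guaranteeing
`E₂(0⁺) = 0`. -/
theorem algebraic_ineq_nonexistence_super (N : ℕ) (hN : 2 < N) (p q δ μ : ℝ)
    (hδ : 0 < δ) (hμ : 0 < μ)
    (hp : 2 ≤ p) (hpq : p ≤ q) (hq : q < (N : ℝ)) (hq2 : 2 < q)
    (hd : 0 < δ * μ - (p - 1) * (q - 1))
    (hineq : 1 / (δ + 1) + 1 / (μ + 1) ≤ ((N : ℝ) - q) / (N * (q - 1))) :
    let k₂ := q + ((N : ℝ) - q) * (q - 2) / (q - 1)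
    let L := (N : ℝ) + k₂ - p - q
    L > (q - 1) * (L + p) / (δ + q - 1) + (p - 1) * (L + q) / (μ + p - 1) := by
  intro k₂ L
  have hN0 : (0 : ℝ) < N := by linarith
  have hq1 : 0 < q - 1 := by linarith
  have hm : 0 < q - 2 := by linarith
  set c := ((N : ℝ) - q) / (N * (q - 1)) with hc
  have hc0 : 0 < c := div_pos (by linarith) (by positivity)
  have hqc : (N : ℝ) * (1 - (q - 1) * c) = q := by
    rw [hc]
    field_simp
    ring
  obtain ⟨A, hA⟩ : ∃ A, A = (N : ℝ) * (1 + (q - 2) * c) := ⟨_, rfl⟩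
  have hA0 : 0 < A := by rw [hA]; positivity
  have hL : L = A - p := by
    simp only [L, k₂, hA, hc]
    field_simp
    ring
  have hsum : 1 / (δ + q - 1) + 1 / (μ + q - 1) ≤ 2 * c / (2 + (q - 2) * c) := by
    rw [one_div_add_sub_one_eq hδ (by linarith), one_div_add_sub_one_eq hμ (by linarith)]
    exact div_add_div_le_of_add_le hm.le (by positivity) (by positivity) hineq
  have hdiag : (q - 1) * A * (2 * c / (2 + (q - 2) * c)) < A - q := by
    have hu : 0 < (q - 2) * c := by positivity
    have hK : (q - 1) * c < 1 := by
      by_contra! h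
      nlinarith
    rw [← mul_div_assoc, div_lt_iff₀ (by positivity)]
    have hgap : (A - q) * (2 + (q - 2) * c) - (q - 1) * A * (2 * c)
        = N * ((q - 2) * c * (2 + (q - 2) * c - (q - 1) * c)) := by
      rw [hA]
      linear_combination (2 + (q - 2) * c) * hqc
    have : 0 < N * ((q - 2) * c * (2 + (q - 2) * c - (q - 1) * c)) :=
      mul_pos hN0 (mul_pos hu (by linarith))
    linarith
  have hmul := mul_le_mul_of_nonneg_left hsum (mul_pos hq1 hA0).le
  rw [mul_add, mul_one_div, mul_one_div] at hmul
  have hmono := add_mul_div_le_of_le hA0.le hμ (by linarith) hpq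
  rw [hL, show A - p + p = A by ring, show A - p + q = A + q - p by ring]
  linarith
end

section
/- Let N > 2 be an integer and let p, q, δ, μ be reals with N/(N−1) < p ≤ q ≤ 2, p < 2, δ, μ > 0, δμ − (p−1)(q−1) > 0, and 1/(δ+1) + 1/(μ+1) ≤ (N(p−1) − p)/(N(p−1)). Set k₂ = p/(p−1) and L = N + k₂ − p − q. Then L > (q−1)(L+p)/(δ+q−1) + (p−1)(L+q)/(μ+p−1). -/
/-- If `A * s < L * (1 - s + b * s)` with `b ≤ 1`, then `A / (d + b)` is dominated by the chord
`L / s * (1 / (d + 1))` as long as `1 / (d + 1) ≤ s`. -/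
theorem div_add_lt_chord {A L b d s : ℝ} (hL : 0 < L) (hb : 0 < b) (hb1 : b ≤ 1) (hd : 0 < d)
    (hs : 0 < s) (hds : 1 / (d + 1) ≤ s) (hA : A * s < L * (1 - s + b * s)) :
    A / (d + b) < L / s * (1 / (d + 1)) := by
  have h1 : 1 ≤ s * (d + 1) := (div_le_iff₀ (by linarith)).1 hds
  rw [div_mul_div_comm, mul_one, div_lt_div_iff₀ (by linarith) (by positivity)]
  have h2 : A * s * (d + 1) < L * (1 - s + b * s) * (d + 1) :=
    mul_lt_mul_of_pos_right hA (by linarith)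
  have h3 : 0 ≤ L * (1 - b) * (s * (d + 1) - 1) :=
    mul_nonneg (mul_nonneg hL.le (by linarith)) (by linarith)
  linarith

/-- The reverse algebraic inequality (2.16) in the subquadratic case, guaranteeing
`E₂(0⁺) = 0`. -/
theorem algebraic_ineq_nonexistence_sub (N : ℕ) (hN : 2 < N) (p q δ μ : ℝ)
    (hδ : 0 < δ) (hμ : 0 < μ)
    (hp : (N : ℝ) / (N - 1) < p) (hpq : p ≤ q) (hq : q ≤ 2) (hp2 : p < 2)
    (hd : 0 < δ * μ - (p - 1) * (q - 1))
    (hineq : 1 / (δ + 1) + 1 / (μ + 1) ≤ ((N : ℝ) * (p - 1) - p) / (N * (p - 1))) :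
    let k₂ := p / (p - 1)
    let L := (N : ℝ) + k₂ - p - q
    L > (q - 1) * (L + p) / (δ + q - 1) + (p - 1) * (L + q) / (μ + p - 1) := by
  intro k₂ L
  have hN' : (2 : ℝ) < N := by exact_mod_cast hN
  have hD : 0 < (N : ℝ) * (p - 1) - p := by
    rw [div_lt_iff₀ (by linarith)] at hp
    linarith
  have hp1 : 1 < p := lt_trans ((one_lt_div (by linarith)).2 (by linarith)) hp
  have ha : 0 < p - 1 := by linarith
  have hb : 0 < q - 1 := by linarith
  have hab : (p - 1) * (q - 1) < 1 := by nlinarith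
  have haL : (p - 1) * L = (N * (p - 1) - p) + (2 * p - (p - 1) * (p + q)) := by
    simp only [L, k₂]
    field_simp
    ring
  have hE : 0 < 2 * p - (p - 1) * (p + q) := by nlinarith
  have hL : 0 < L := by
    refine pos_of_mul_pos_right (a := p - 1) ?_ ha.le
    linarith
  have hNa : 0 < (N : ℝ) * (p - 1) := by positivity
  set s := ((N : ℝ) * (p - 1) - p) / (N * (p - 1)) with hs_def
  have hs : 0 < s := div_pos hD hNa
  have hsN : s * (N * (p - 1)) = N * (p - 1) - p := div_mul_cancel₀ _ hNa.ne'
  have hx : 0 < 1 / (δ + 1) := by positivity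
  have hy : 0 < 1 / (μ + 1) := by positivity
  have h₁ : (q - 1) * (N * (p - 1) - p) < L := by
    refine lt_of_mul_lt_mul_left (a := p - 1) ?_ ha.le
    nlinarith [mul_pos (sub_pos.2 hab) hD]
  have h₂ : (p - 1) * q * (N * (p - 1) - p) < L * p := by
    refine lt_of_mul_lt_mul_left (a := p - 1) ?_ ha.le
    have hq' : (p - 1) * (p - 1) * q < p := by nlinarith
    nlinarith [mul_pos (sub_pos.2 hq') hD, mul_pos (zero_lt_one.trans hp1) hE]
  have hA₁ : (q - 1) * (L + p) * s < L * (1 - s + (q - 1) * s) := by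
    refine lt_of_mul_lt_mul_right (a := (N : ℝ) * (p - 1)) ?_ hNa.le
    linear_combination p * h₁ + ((q - 1) * p + L) * hsN
  have hA₂ : (p - 1) * (L + q) * s < L * (1 - s + (p - 1) * s) := by
    refine lt_of_mul_lt_mul_right (a := (N : ℝ) * (p - 1)) ?_ hNa.le
    linear_combination h₂ + ((p - 1) * q + L) * hsN
  have hf := div_add_lt_chord hL hb (by linarith) hδ hs (by linarith) hA₁
  have hg := div_add_lt_chord hL ha (by linarith) hμ hs (by linarith) hA₂
  have hsum : L / s * (1 / (δ + 1)) + L / s * (1 / (μ + 1)) ≤ L := by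
    rw [← mul_add]
    calc L / s * (1 / (δ + 1) + 1 / (μ + 1)) ≤ L / s * s := by gcongr
      _ = L := div_mul_cancel₀ _ hs.ne'
  rw [add_sub_assoc, add_sub_assoc]
  linarith
end
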